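/- arXiv:0711.4179 — 2 statements merged into one kernel-verified Lean document; each statement's English description precedes it below -/
import Mathlib

section
/- Let η > 0 and B ≥ 1, and let A(k), k ≥ 0, be a sequence of n×n doubly stochastic matrices with positive diagonal entries whose positive entries are all at least η. Let x(k+1) = A(k)x(k) for all k, and fix an integer k ≥ 0 such that the components of x(kB) are in nonincreasing order: x_1(kB) ≥ x_2(kB) ≥ ⋯ ≥ x_n(kB). Assume that for every d ∈ {1,…,n−1}, either x_d(kB) = x_{d+1}(kB), or there exist a time t ∈ {kB,…,(k+1)B−1} and indices i ∈ {1,…,d}, j ∈ {d+1,…,n} such that (i,j) or (j,i) belongs to E(A(t)). Then V(x(kB)) − V(x((k+1)B)) ≥ (η/2) Σ_{i=1}^{n−1} (x_i(kB) − x_{i+1}(kB))². -/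
open Matrix Finset Real Filter

/-- A matrix is doubly stochastic if entrywise nonnegative with all rows and columns summing to 1. -/
def IsDoublyStochastic {n : ℕ} (A : Matrix (Fin n) (Fin n) ℝ) : Prop :=
  (∀ i j, 0 ≤ A i j) ∧ (∀ i, ∑ j, A i j = 1) ∧ (∀ j, ∑ i, A i j = 1)

/-- The average of the components of a vector. -/
noncomputable def avgVec {n : ℕ} (x : Fin n → ℝ) : ℝ := (∑ i, x i) / n

/-- The sample variance V(x) = Σ_i (x_i - x̄)². -/
noncomputable def sampleVar {n : ℕ} (x : Fin n → ℝ) : ℝ := ∑ i, (x i - avgVec x) ^ 2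

/-- The Lyapunov function V̲(x) = Σ_i (x_i - min_j x_j)². -/
noncomputable def underVar {n : ℕ} (x : Fin n → ℝ) : ℝ := ∑ i, (x i - ⨅ j, x j) ^ 2

/-- Σ_{i=1}^{n-1} (x_i - x_{i+1})² for a vector indexed by `Fin n`. -/
noncomputable def sumSqDiff {n : ℕ} (x : Fin n → ℝ) : ℝ :=
  ∑ i : Fin n, if h : (i : ℕ) + 1 < n then (x i - x ⟨(i : ℕ) + 1, h⟩) ^ 2 else 0

/-- Rounding down to the nearest multiple of 1/Q. -/
noncomputable def qfloor (Q : ℕ) (y : ℝ) : ℝ := (⌊(Q : ℝ) * y⌋ : ℝ) / Q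

/-- Doubly stochastic with positive diagonal and all positive entries at least η. -/
def GoodWeights {n : ℕ} (η : ℝ) (A : Matrix (Fin n) (Fin n) ℝ) : Prop :=
  IsDoublyStochastic A ∧ (∀ i, 0 < A i i) ∧ ∀ i j, 0 < A i j → η ≤ A i j

/-- The directed graph with edges `E(A(kB)) ∪ ⋯ ∪ E(A((k+1)B-1))` is strongly connected;
here `(j,i) ∈ E(A)` iff `A i j > 0`. -/
def BlockConnected {n : ℕ} (A : ℕ → Matrix (Fin n) (Fin n) ℝ) (B k : ℕ) : Prop :=
  ∀ u v : Fin n,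
    Relation.ReflTransGen (fun a b => ∃ t, k * B ≤ t ∧ t < (k + 1) * B ∧ 0 < A t b a) u v

/-- Assumption 3 of the paper for the (already sorted) vector `y = x(kB)`: for every cut `d`,
either the d-th and (d+1)-th components are equal, or some edge crosses the cut during
the time block `[kB, (k+1)B)`. -/
def CutCondition {n : ℕ} (A : ℕ → Matrix (Fin n) (Fin n) ℝ) (B k : ℕ) (y : Fin n → ℝ) : Prop :=
  ∀ d : Fin n, ∀ h : (d : ℕ) + 1 < n,
    y d = y ⟨(d : ℕ) + 1, h⟩ ∨
      ∃ t, k * B ≤ t ∧ t < (k + 1) * B ∧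
        ∃ i j : Fin n, i ≤ d ∧ d < j ∧ (0 < A t i j ∨ 0 < A t j i)

/-- Assumption 3 of the paper at time block `k`: after reordering the components of `x`
in nonincreasing order via a permutation `σ`, for every cut `d`, either the d-th and
(d+1)-th ordered components are equal, or some edge crossing the cut appears during the
time block `[kB, (k+1)B)`. -/
def CutConditionPerm {n : ℕ} (A : ℕ → Matrix (Fin n) (Fin n) ℝ) (B k : ℕ)
    (x : Fin n → ℝ) : Prop :=
  ∃ σ : Equiv.Perm (Fin n), Antitone (x ∘ σ) ∧
    ∀ d : Fin n, ∀ h : (d : ℕ) + 1 < n,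
      x (σ d) = x (σ ⟨(d : ℕ) + 1, h⟩) ∨
        ∃ t, k * B ≤ t ∧ t < (k + 1) * B ∧
          ∃ i j : Fin n, i ≤ d ∧ d < j ∧ (0 < A t (σ i) (σ j) ∨ 0 < A t (σ j) (σ i))

/-- crossing of the cut `d` at time `t` -/
def Crosses {n : ℕ} (M : Matrix (Fin n) (Fin n) ℝ) (d : ℕ) : Prop :=
  ∃ i j : Fin n, (i : ℕ) ≤ d ∧ d < (j : ℕ) ∧ (0 < M i j ∨ 0 < M j i)

lemma aux_var {n : ℕ} (z : Fin n → ℝ) :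
    sampleVar z = ∑ i, z i ^ 2 - (∑ i, z i) ^ 2 / n := by
  unfold sampleVar avgVec
  rcases Nat.eq_zero_or_pos n with h | h
  · subst h; simp
  have hn : (n : ℝ) ≠ 0 := by positivity
  have : ∀ i, (z i - (∑ i, z i) / n) ^ 2
      = z i ^ 2 - 2 * ((∑ i, z i) / n) * z i + ((∑ i, z i) / n) ^ 2 := fun i => by ring
  simp only [this, Finset.sum_add_distrib, Finset.sum_sub_distrib, ← Finset.mul_sum]
  simp
  field_simp
  ring

lemma aux_row {n : ℕ} (a z : Fin n → ℝ) (h : ∑ j, a j = 1) :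
    ∑ j, a j * z j ^ 2 - (∑ j, a j * z j) ^ 2
      = (1 / 2) * ∑ i, ∑ j, a i * a j * (z i - z j) ^ 2 := by
  have e : ∀ i j, a i * a j * (z i - z j) ^ 2
      = (a i * z i ^ 2) * a j - 2 * ((a i * z i) * (a j * z j)) + a i * (a j * z j ^ 2) :=
    fun i j => by ring
  simp only [e, Finset.sum_add_distrib, Finset.sum_sub_distrib, ← Finset.mul_sum, h,
    ← Finset.sum_mul]
  ring

lemma aux_drop {n : ℕ} (M : Matrix (Fin n) (Fin n) ℝ) (hM : IsDoublyStochastic M)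
    (z : Fin n → ℝ) :
    sampleVar z - sampleVar (M.mulVec z)
      = (1 / 2) * ∑ m, ∑ i, ∑ j, M m i * M m j * (z i - z j) ^ 2 := by
  obtain ⟨h0, hr, hc⟩ := hM
  have hs : ∀ w : Fin n → ℝ, ∑ m, ∑ j, M m j * w j = ∑ j, w j := by
    intro w
    rw [Finset.sum_comm]
    simp [← Finset.sum_mul, hc]
  rw [aux_var, aux_var]
  simp only [Matrix.mulVec, dotProduct]
  rw [hs z, ← hs (fun j => z j ^ 2), Finset.mul_sum]
  simp only [← aux_row _ z (hr _), Finset.sum_sub_distrib]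
  ring

lemma aux_cut {n : ℕ} {η : ℝ} (hη : 0 < η) (M : Matrix (Fin n) (Fin n) ℝ)
    (hM : GoodWeights η M) (d : ℕ) (hd : Crosses M d) :
    η ≤ ∑ m, ∑ i, ∑ j, M m i * M m j *
      ((if (i : ℕ) ≤ d ∧ d < (j : ℕ) then 1 else 0) +
        (if (j : ℕ) ≤ d ∧ d < (i : ℕ) then 1 else 0)) := by
  obtain ⟨⟨h0, hr, hc⟩, hdiag, hpos⟩ := hM
  set S : Fin n → ℝ := fun m => ∑ i : Fin n, if (i : ℕ) ≤ d then M m i else 0 with hS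
  set T : Fin n → ℝ := fun m => ∑ i : Fin n, if d < (i : ℕ) then M m i else 0 with hT
  have hST : ∀ m, S m + T m = 1 := by
    intro m
    rw [← hr m, hS, hT, ← Finset.sum_add_distrib]
    refine Finset.sum_congr rfl fun i _ => ?_
    by_cases h : (i : ℕ) ≤ d
    · simp [h]
    · simp [h, not_le.mp h]
  have hS0 : ∀ m, 0 ≤ S m := fun m => Finset.sum_nonneg fun i _ => by
    split_ifs <;> simp [h0]
  have hT0 : ∀ m, 0 ≤ T m := fun m => Finset.sum_nonneg fun i _ => by
    split_ifs <;> simp [h0]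
  have hSge : ∀ m (i : Fin n), (i : ℕ) ≤ d → 0 < M m i → η ≤ S m := by
    intro m i hi hp
    refine (hpos m i hp).trans ?_
    have := Finset.single_le_sum (f := fun i : Fin n => if (i : ℕ) ≤ d then M m i else 0)
      (fun i _ => by split_ifs <;> simp [h0]) (Finset.mem_univ i)
    simpa [hi] using this
  have hTge : ∀ m (i : Fin n), d < (i : ℕ) → 0 < M m i → η ≤ T m := by
    intro m i hi hp
    refine (hpos m i hp).trans ?_
    have := Finset.single_le_sum (f := fun i : Fin n => if d < (i : ℕ) then M m i else 0)
      (fun i _ => by split_ifs <;> simp [h0]) (Finset.mem_univ i)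
    simpa [hi] using this
  have key : ∀ m, ∑ i, ∑ j, M m i * M m j *
      ((if (i : ℕ) ≤ d ∧ d < (j : ℕ) then (1:ℝ) else 0) +
        (if (j : ℕ) ≤ d ∧ d < (i : ℕ) then 1 else 0)) = 2 * (S m * T m) := by
    intro m
    have e1 : S m * T m = ∑ i, ∑ j, M m i * M m j *
        (if (i : ℕ) ≤ d ∧ d < (j : ℕ) then (1:ℝ) else 0) := by
      rw [hS, hT, Finset.sum_mul_sum]
      refine Finset.sum_congr rfl fun i _ => Finset.sum_congr rfl fun j _ => ?_
      by_cases h1 : (i : ℕ) ≤ d <;> by_cases h2 : d < (j : ℕ) <;> simp [h1, h2]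
    have e2 : S m * T m = ∑ i, ∑ j, M m i * M m j *
        (if (j : ℕ) ≤ d ∧ d < (i : ℕ) then (1:ℝ) else 0) := by
      rw [mul_comm, hS, hT, Finset.sum_mul_sum]
      refine Finset.sum_congr rfl fun i _ => Finset.sum_congr rfl fun j _ => ?_
      by_cases h1 : (j : ℕ) ≤ d <;> by_cases h2 : d < (i : ℕ) <;> simp [h1, h2]
    simp only [mul_add, Finset.sum_add_distrib]
    rw [← e1, ← e2]; ring
  have : ∃ m, η ≤ S m ∧ η ≤ T m := by
    obtain ⟨i, j, hi, hj, h | h⟩ := hd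
    · exact ⟨i, hSge i i hi (hdiag i), hTge i j hj h⟩
    · exact ⟨j, hSge j i hi h, hTge j j hj (hdiag j)⟩
  obtain ⟨m, h1, h2⟩ := this
  simp only [key]
  have h3 := Finset.single_le_sum (f := fun m => 2 * (S m * T m))
    (fun m _ => by have := hS0 m; have := hT0 m; positivity) (Finset.mem_univ m)
  refine le_trans ?_ h3
  have h4 := hST m
  have h5 : T m = 1 - S m := by linarith
  rw [h5] at h2 ⊢
  rcases le_total (S m) (1/2) with h | h <;> nlinarith

lemma aux_tel (Y : ℕ → ℝ) (hY : Antitone Y) (T : Finset ℕ) (a b : ℕ) (hab : a ≤ b)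
    (hT : ∀ d ∈ T, a ≤ d ∧ d < b) : ∑ d ∈ T, (Y d - Y (d + 1)) ≤ Y a - Y b := by
  have : ∑ d ∈ Finset.Ico a b, (Y d - Y (d + 1)) = Y a - Y b := by
    induction b, hab using Nat.le_induction with
    | base => simp
    | succ b hb ih =>
      have key : ∀ b, a ≤ b → ∑ d ∈ Finset.Ico a b, (Y d - Y (d + 1)) = Y a - Y b := by
        intro b hb
        induction b, hb using Nat.le_induction with
        | base => simp
        | succ b hb ih => rw [Finset.sum_Ico_succ_top hb, ih]; ring
      exact key _ (by omega)
  rw [← this]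
  refine Finset.sum_le_sum_of_subset_of_nonneg (fun d hd => by simpa using hT d hd) ?_
  intro d _ _
  have := hY (Nat.le_succ d)
  simpa using this

lemma aux_half (Y : ℕ → ℝ) (hY : Antitone Y) (D : Finset ℕ) (i j : ℕ) (p q : ℝ)
    (h1 : ∀ d ∈ D, i ≤ d → Y d ≤ p) (h2 : ∀ d ∈ D, d < j → q ≤ Y (d + 1)) :
    ∑ d ∈ D, (Y d - Y (d + 1)) ^ 2 * (if i ≤ d ∧ d < j then (1:ℝ) else 0) ≤ (p - q) ^ 2 := by
  simp only [mul_ite, mul_one, mul_zero]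
  rw [← Finset.sum_filter]
  set T := D.filter (fun d => i ≤ d ∧ d < j) with hT
  have hg : ∀ d, 0 ≤ Y d - Y (d + 1) := fun d => by
    have := hY (Nat.le_succ d)
    simpa using this
  rcases T.eq_empty_or_nonempty with h | h
  · rw [h]; simp; positivity
  have m1 := T.min'_mem h
  have m2 := T.max'_mem h
  have b1 := h1 _ (Finset.mem_filter.mp m1).1 (Finset.mem_filter.mp m1).2.1
  have b2 := h2 _ (Finset.mem_filter.mp m2).1 (Finset.mem_filter.mp m2).2.2
  have b3 := aux_tel Y hY T (T.min' h) (T.max' h + 1) (by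
    have := T.min'_le _ m2; omega) (fun d hd => ⟨T.min'_le _ hd, by
      have := T.le_max' _ hd; omega⟩)
  calc ∑ d ∈ T, (Y d - Y (d + 1)) ^ 2 ≤ (∑ d ∈ T, (Y d - Y (d + 1))) ^ 2 :=
        Finset.sum_sq_le_sq_sum_of_nonneg (fun d _ => hg d)
    _ ≤ _ := pow_le_pow_left₀ (Finset.sum_nonneg fun d _ => hg d) (by linarith) 2

lemma aux_pair (Y : ℕ → ℝ) (hY : Antitone Y) (D : Finset ℕ) (i j : ℕ) (p q : ℝ)
    (h1 : ∀ d ∈ D, i ≤ d → Y d ≤ p) (h2 : ∀ d ∈ D, d < j → q ≤ Y (d + 1))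
    (h3 : ∀ d ∈ D, j ≤ d → Y d ≤ q) (h4 : ∀ d ∈ D, d < i → p ≤ Y (d + 1)) :
    ∑ d ∈ D, (Y d - Y (d + 1)) ^ 2 * ((if i ≤ d ∧ d < j then (1:ℝ) else 0) +
      (if j ≤ d ∧ d < i then 1 else 0)) ≤ (p - q) ^ 2 := by
  simp only [mul_add, Finset.sum_add_distrib]
  rcases le_total i j with h | h
  · have := aux_half Y hY D i j p q h1 h2
    have e : ∑ d ∈ D, (Y d - Y (d + 1)) ^ 2 * (if j ≤ d ∧ d < i then (1:ℝ) else 0) = 0 :=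
      Finset.sum_eq_zero fun d _ => by rw [if_neg (by omega)]; simp
    linarith
  · have := aux_half Y hY D j i q p h3 h4
    have e : ∑ d ∈ D, (Y d - Y (d + 1)) ^ 2 * (if i ≤ d ∧ d < j then (1:ℝ) else 0) = 0 :=
      Finset.sum_eq_zero fun d _ => by rw [if_neg (by omega)]; simp
    have e2 : (p - q) ^ 2 = (q - p) ^ 2 := by ring
    linarith

lemma aux_step {n : ℕ} {η : ℝ} (hη : 0 < η) (M : Matrix (Fin n) (Fin n) ℝ)
    (hM : GoodWeights η M) (z : Fin n → ℝ) (Y : ℕ → ℝ) (hY : Antitone Y) (D : Finset ℕ)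
    (hD : ∀ d ∈ D, Crosses M d)
    (h1 : ∀ d ∈ D, ∀ i : Fin n, (i : ℕ) ≤ d → Y d ≤ z i)
    (h2 : ∀ d ∈ D, ∀ i : Fin n, d < (i : ℕ) → z i ≤ Y (d + 1)) :
    η / 2 * ∑ d ∈ D, (Y d - Y (d + 1)) ^ 2 ≤ sampleVar z - sampleVar (M.mulVec z) := by
  rw [aux_drop M hM.1 z]
  have h0 := hM.1.1
  have step1 : ∑ m, ∑ i, ∑ j, M m i * M m j * (∑ d ∈ D, (Y d - Y (d + 1)) ^ 2 *
      ((if (i : ℕ) ≤ d ∧ d < (j : ℕ) then (1:ℝ) else 0) +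
        (if (j : ℕ) ≤ d ∧ d < (i : ℕ) then 1 else 0)))
      ≤ ∑ m, ∑ i, ∑ j, M m i * M m j * (z i - z j) ^ 2 := by
    refine Finset.sum_le_sum fun m _ => Finset.sum_le_sum fun i _ =>
      Finset.sum_le_sum fun j _ => ?_
    refine mul_le_mul_of_nonneg_left ?_ (mul_nonneg (h0 _ _) (h0 _ _))
    exact aux_pair Y hY D i j (z i) (z j) (fun d hd => h1 d hd i) (fun d hd => h2 d hd j)
      (fun d hd => h1 d hd j) (fun d hd => h2 d hd i)
  have step2 : ∑ m, ∑ i, ∑ j, M m i * M m j * (∑ d ∈ D, (Y d - Y (d + 1)) ^ 2 *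
      ((if (i : ℕ) ≤ d ∧ d < (j : ℕ) then (1:ℝ) else 0) +
        (if (j : ℕ) ≤ d ∧ d < (i : ℕ) then 1 else 0)))
      = ∑ d ∈ D, (Y d - Y (d + 1)) ^ 2 * ∑ m, ∑ i, ∑ j, M m i * M m j *
      ((if (i : ℕ) ≤ d ∧ d < (j : ℕ) then (1:ℝ) else 0) +
        (if (j : ℕ) ≤ d ∧ d < (i : ℕ) then 1 else 0)) := by
    have sw : ∀ (F : Fin n → ℕ → ℝ), ∑ m, ∑ d ∈ D, F m d = ∑ d ∈ D, ∑ m, F m d :=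
      fun F => Finset.sum_comm
    simp only [Finset.mul_sum]
    simp only [sw]
    refine Finset.sum_congr rfl fun d _ => Finset.sum_congr rfl fun m _ =>
      Finset.sum_congr rfl fun i _ => Finset.sum_congr rfl fun j _ => ?_
    ring
  have step3 : ∑ d ∈ D, (Y d - Y (d + 1)) ^ 2 * η ≤ ∑ d ∈ D, (Y d - Y (d + 1)) ^ 2 *
      ∑ m, ∑ i, ∑ j, M m i * M m j *
      ((if (i : ℕ) ≤ d ∧ d < (j : ℕ) then (1:ℝ) else 0) +
        (if (j : ℕ) ≤ d ∧ d < (i : ℕ) then 1 else 0)) :=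
    Finset.sum_le_sum fun d hd =>
      mul_le_mul_of_nonneg_left (aux_cut hη M hM d (hD d hd)) (sq_nonneg _)
  rw [← Finset.sum_mul] at step3
  linarith

lemma aux_inv {n : ℕ} (A : ℕ → Matrix (Fin n) (Fin n) ℝ)
    (hA : ∀ k, IsDoublyStochastic (A k))
    (x : ℕ → Fin n → ℝ) (hx : ∀ k, x (k + 1) = (A k).mulVec (x k)) (s d : ℕ) (u v : ℝ)
    (hu : ∀ i : Fin n, (i : ℕ) ≤ d → u ≤ x s i) (hv : ∀ i : Fin n, d < (i : ℕ) → x s i ≤ v)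
    (t : ℕ) (hst : s ≤ t) (hno : ∀ r, s ≤ r → r < t → ¬ Crosses (A r) d) :
    (∀ i : Fin n, (i : ℕ) ≤ d → u ≤ x t i) ∧ (∀ i : Fin n, d < (i : ℕ) → x t i ≤ v) := by
  induction t, hst using Nat.le_induction with
  | base => exact ⟨hu, hv⟩
  | succ t hst ih =>
    obtain ⟨ih1, ih2⟩ := ih (fun r h1 h2 => hno r h1 (by omega))
    have hn := hno t hst (by omega)
    obtain ⟨h0, hr, hc⟩ := hA t
    have z1 : ∀ i j : Fin n, (i : ℕ) ≤ d → d < (j : ℕ) → A t i j = 0 ∧ A t j i = 0 := by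
      intro i j hi hj
      constructor
      · by_contra h
        exact hn ⟨i, j, hi, hj, Or.inl (lt_of_le_of_ne (h0 _ _) (Ne.symm h))⟩
      · by_contra h
        exact hn ⟨i, j, hi, hj, Or.inr (lt_of_le_of_ne (h0 _ _) (Ne.symm h))⟩
    rw [hx]
    simp only [Matrix.mulVec, dotProduct]
    constructor
    · intro i hi
      have : u = ∑ j, A t i j * u := by rw [← Finset.sum_mul, hr, one_mul]
      rw [this]
      refine Finset.sum_le_sum fun j _ => ?_
      by_cases hj : (j : ℕ) ≤ d
      · exact mul_le_mul_of_nonneg_left (ih1 j hj) (h0 _ _)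
      · rw [(z1 i j hi (not_le.mp hj)).1]; simp
    · intro i hi
      have : v = ∑ j, A t i j * v := by rw [← Finset.sum_mul, hr, one_mul]
      rw [this]
      refine Finset.sum_le_sum fun j _ => ?_
      by_cases hj : d < (j : ℕ)
      · exact mul_le_mul_of_nonneg_left (ih2 j hj) (h0 _ _)
      · rw [(z1 j i (not_lt.mp hj) hi).2]; simp

open Classical in
lemma aux_main {n : ℕ} {η : ℝ} (hη : 0 < η) (A : ℕ → Matrix (Fin n) (Fin n) ℝ)
    (hA : ∀ k, GoodWeights η (A k))
    (x : ℕ → Fin n → ℝ) (hx : ∀ k, x (k + 1) = (A k).mulVec (x k)) (s : ℕ)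
    (Y : ℕ → ℝ) (hY : Antitone Y) (hYx : ∀ i : Fin n, Y i = x s i) (t : ℕ) (hst : s ≤ t) :
    η / 2 * ∑ d ∈ (Finset.range n).filter (fun d => ∃ r, s ≤ r ∧ r < t ∧ Crosses (A r) d),
      (Y d - Y (d + 1)) ^ 2 ≤ sampleVar (x s) - sampleVar (x t) := by
  induction t, hst using Nat.le_induction with
  | base =>
    rw [Finset.filter_false_of_mem]
    · simp
    · rintro d _ ⟨r, h1, h2, _⟩; omega
  | succ t hst ih =>
    set D := (Finset.range n).filter (fun d =>
      (¬ ∃ r, s ≤ r ∧ r < t ∧ Crosses (A r) d) ∧ Crosses (A t) d) with hD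
    have hun : (Finset.range n).filter (fun d => ∃ r, s ≤ r ∧ r < t + 1 ∧ Crosses (A r) d)
        = (Finset.range n).filter (fun d => ∃ r, s ≤ r ∧ r < t ∧ Crosses (A r) d) ∪ D := by
      ext d
      simp only [hD, Finset.mem_union, Finset.mem_filter]
      constructor
      · rintro ⟨hd, r, h1, h2, h3⟩
        by_cases h : ∃ r, s ≤ r ∧ r < t ∧ Crosses (A r) d
        · exact Or.inl ⟨hd, h⟩
        · right
          refine ⟨hd, h, ?_⟩
          have : r = t := by
            by_contra hne
            exact h ⟨r, h1, by omega, h3⟩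
          exact this ▸ h3
      · rintro (⟨hd, r, h1, h2, h3⟩ | ⟨hd, _, h⟩)
        · exact ⟨hd, r, h1, by omega, h3⟩
        · exact ⟨hd, t, hst, by omega, h⟩
    have hdis : Disjoint ((Finset.range n).filter
        (fun d => ∃ r, s ≤ r ∧ r < t ∧ Crosses (A r) d)) D := by
      rw [Finset.disjoint_left]
      intro d h1 h2
      exact (Finset.mem_filter.mp h2).2.1 (Finset.mem_filter.mp h1).2
    rw [hun, Finset.sum_union hdis, mul_add]
    have hinv : ∀ d ∈ D, (∀ i : Fin n, (i : ℕ) ≤ d → Y d ≤ x t i) ∧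
        (∀ i : Fin n, d < (i : ℕ) → x t i ≤ Y (d + 1)) := by
      intro d hd
      refine aux_inv A (fun k => (hA k).1) x hx s d _ _ ?_ ?_ t hst ?_
      · intro i hi; rw [← hYx]; exact hY hi
      · intro i hi; rw [← hYx]; exact hY hi
      · intro r h1 h2 h3
        exact (Finset.mem_filter.mp hd).2.1 ⟨r, h1, h2, h3⟩
    have := aux_step hη (A t) (hA t) (x t) Y hY D
      (fun d hd => (Finset.mem_filter.mp hd).2.2) (fun d hd => (hinv d hd).1)
      (fun d hd => (hinv d hd).2)
    rw [← hx] at this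
    linarith

/-- If `x(kB)` is in nonincreasing order and for every cut either the two
adjacent ordered components are equal or an edge crosses the cut during the block, then
`V(x(kB)) - V(x((k+1)B)) ≥ (η/2) Σ_{i=1}^{n-1} (x_i(kB) - x_{i+1}(kB))²`. -/
theorem stmt4 {n : ℕ} (η : ℝ) (hη : 0 < η) (B : ℕ) (hB : 1 ≤ B)
    (A : ℕ → Matrix (Fin n) (Fin n) ℝ) (hA : ∀ k, GoodWeights η (A k))
    (x : ℕ → Fin n → ℝ) (hx : ∀ k, x (k + 1) = (A k).mulVec (x k))
    (k : ℕ) (hord : Antitone (x (k * B)))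
    (hcut : CutCondition A B k (x (k * B))) :
    η / 2 * sumSqDiff (x (k * B)) ≤ sampleVar (x (k * B)) - sampleVar (x ((k + 1) * B)) := by
  classical
  rcases Nat.eq_zero_or_pos n with h | hn
  · subst h; simp [sumSqDiff, sampleVar]
  set y := x (k * B) with hy
  set Y : ℕ → ℝ := fun m => y ⟨min m (n - 1), by omega⟩ with hYdef
  have hY : Antitone Y := by
    intro a b hab
    apply hord
    simp only [Fin.mk_le_mk]
    omega
  have hYx : ∀ i : Fin n, Y i = y i := by
    intro i
    simp only [hYdef]
    congr 1
    ext
    simp only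
    omega
  have hmain := aux_main hη A hA x hx (k * B) Y hY hYx ((k + 1) * B)
    (Nat.mul_le_mul_right _ (by omega))
  refine le_trans (mul_le_mul_of_nonneg_left ?_ (by positivity)) hmain
  have e : sumSqDiff y = ∑ d ∈ Finset.range n, (Y d - Y (d + 1)) ^ 2 := by
    unfold sumSqDiff
    rw [Finset.sum_range]
    refine Finset.sum_congr rfl fun i _ => ?_
    split_ifs with h
    · rw [hYx, ← hYx ⟨(i : ℕ) + 1, h⟩]
    · have : Y ((i : ℕ) + 1) = Y i := by
        simp only [hYdef]
        congr 2
        omega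
      rw [this]; simp
  rw [e, Finset.sum_filter]
  refine Finset.sum_le_sum fun d hd => ?_
  split_ifs with hc
  · exact le_rfl
  · have hdn := Finset.mem_range.mp hd
    have : Y (d + 1) = Y d := by
      by_cases h : d + 1 < n
      · rcases hcut ⟨d, hdn⟩ h with h1 | ⟨t, h1, h2, i, j, hi, hj, h3⟩
        · have a1 := hYx ⟨d, hdn⟩
          have a2 := hYx ⟨d + 1, h⟩
          simp only at a1 a2 h1
          rw [a1, a2, h1]
        · exact absurd ⟨t, h1, h2, i, j, hi, hj, h3⟩ hc
      · simp only [hYdef]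
        congr 2
        omega
    rw [this]; simp
end

section
/- Let η > 0, B ≥ 1, and Q a positive integer. Let A(k), k ≥ 0, be a sequence of n×n doubly stochastic matrices with positive diagonal entries whose positive entries are all at least η. Let x(0) ∈ ℝⁿ have all components equal to multiples of 1/Q, and let the sequence evolve by the quantized update x_i(k+1) = ⌊Σ_{j=1}^n a_{ij}(k) x_j(k)⌋_{1/Q}. Fix k ≥ 0 such that the components of x(kB) are in nonincreasing order: x_1(kB) ≥ ⋯ ≥ x_n(kB), and assume that for every d ∈ {1,…,n−1}, either x_d(kB) = x_{d+1}(kB), or there exist a time t ∈ {kB,…,(k+1)B−1} and indices i ∈ {1,…,d}, j ∈ {d+1,…,n} such that (i,j) or (j,i) belongs to E(A(t)). Then V̲(x(kB)) − V̲(x((k+1)B)) ≥ (η/2) Σ_{i=1}^{n−1} (x_i(kB) − x_{i+1}(kB))². -/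
open Matrix Finset Real Filter

/-- successor value -/
noncomputable def nxtV {n : ℕ} (y : Fin n → ℝ) (d : Fin n) : ℝ :=
  if h : (d : ℕ) + 1 < n then y ⟨(d : ℕ) + 1, h⟩ else y d

/-- crossing of the cut d -/
def CrossAt {n : ℕ} (M : Matrix (Fin n) (Fin n) ℝ) (d : Fin n) : Prop :=
  ∃ i j : Fin n, i ≤ d ∧ d < j ∧ (0 < M i j ∨ 0 < M j i)

lemma sumSqDiff_eq_nxt {n : ℕ} (y : Fin n → ℝ) :
    sumSqDiff y = ∑ d, (y d - nxtV y d) ^ 2 := by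
  unfold sumSqDiff nxtV
  refine Finset.sum_congr rfl fun i _ => ?_
  split_ifs <;> simp

lemma nxtV_le {n : ℕ} {y : Fin n → ℝ} (hy : Antitone y) (d : Fin n) : nxtV y d ≤ y d := by
  unfold nxtV
  split_ifs with h
  · apply hy; rw [Fin.le_def]; simp
  · exact le_rfl

lemma le_nxtV {n : ℕ} {y : Fin n → ℝ} (hy : Antitone y) {d a : Fin n} (hda : d < a) :
    y a ≤ nxtV y d := by
  have h : (d : ℕ) + 1 < n := by have := a.2; rw [Fin.lt_def] at hda; omega
  unfold nxtV
  rw [dif_pos h]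
  apply hy; rw [Fin.le_def]; exact hda

lemma sum_gap_le {n : ℕ} {y : Fin n → ℝ} (hy : Antitone y) (u : ℝ) (F : Finset (Fin n)) :
    (∀ d ∈ F, y d ≤ u) → ∀ v, (∀ d ∈ F, v ≤ nxtV y d) → v ≤ u →
      ∑ d ∈ F, (y d - nxtV y d) ^ 2 ≤ (u - v) ^ 2 := by
  induction F using Finset.induction_on_max with
  | empty => intro _ v _ _; simpa using sq_nonneg _
  | insert a s hs ih =>
    intro h1 v h2 hvu
    have hna : a ∉ s := fun h => lt_irrefl _ (hs a h)
    rw [Finset.sum_insert hna]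
    have e1 := h1 a (by simp)
    have e2 := h2 a (by simp)
    have e3 := nxtV_le hy a
    have := ih (fun d hd => h1 d (by simp [hd])) (y a) (fun d hd => le_nxtV hy (hs d hd)) e1
    nlinarith [mul_nonneg (sub_nonneg.2 e1) (sub_nonneg.2 e3),
      mul_nonneg (sub_nonneg.2 e2) (sub_nonneg.2 e1), mul_nonneg (sub_nonneg.2 e2) (sub_nonneg.2 e3), sq_nonneg (nxtV y a - v)]

/-- cut indicator -/
noncomputable def cutInd {n : ℕ} (d i j : Fin n) : ℝ := if i ≤ d ∧ d < j then 1 else 0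

lemma pair_le {n : ℕ} {y : Fin n → ℝ} (hy : Antitone y) (z : Fin n → ℝ) (F : Finset (Fin n))
    (h1 : ∀ d ∈ F, ∀ i, i ≤ d → y d ≤ z i) (h2 : ∀ d ∈ F, ∀ j, d < j → z j ≤ nxtV y d)
    (i j : Fin n) :
    ∑ d ∈ F, cutInd d i j * (y d - nxtV y d) ^ 2 ≤ (if i < j then (z i - z j) ^ 2 else 0) := by
  split_ifs with hij
  · have : ∑ d ∈ F, cutInd d i j * (y d - nxtV y d) ^ 2
        = ∑ d ∈ F with (i ≤ d ∧ d < j), (y d - nxtV y d) ^ 2 := by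
      rw [Finset.sum_filter]
      refine Finset.sum_congr rfl fun d _ => ?_
      unfold cutInd; split_ifs <;> simp
    rw [this]
    rcases Finset.eq_empty_or_nonempty (F.filter fun d => i ≤ d ∧ d < j) with h | ⟨d, hd⟩
    · rw [h]; simpa using sq_nonneg _
    · apply sum_gap_le hy
      · intro d hd; simp only [Finset.mem_filter] at hd; exact h1 d hd.1 i hd.2.1
      · intro d hd; simp only [Finset.mem_filter] at hd; exact h2 d hd.1 j hd.2.2
      · simp only [Finset.mem_filter] at hd
        exact (h2 d hd.1 j hd.2.2).trans ((nxtV_le hy d).trans (h1 d hd.1 i hd.2.1))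
  · apply le_of_eq
    apply Finset.sum_eq_zero
    intro d _
    unfold cutInd
    rw [if_neg, zero_mul]
    rintro ⟨a, b⟩
    exact hij (lt_of_le_of_lt a b)

lemma row_var {n : ℕ} (a z : Fin n → ℝ) (ha : ∑ j, a j = 1) :
    ∑ j, a j * z j ^ 2 - (∑ j, a j * z j) ^ 2
      = 1 / 2 * ∑ i, ∑ j, a i * a j * (z i - z j) ^ 2 := by
  have : ∑ i, ∑ j, a i * a j * (z i - z j) ^ 2
      = (∑ i, a i * z i ^ 2) * (∑ j, a j) - 2 * ((∑ i, a i * z i) * (∑ j, a j * z j))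
        + (∑ i, a i) * (∑ j, a j * z j ^ 2) := by
    rw [Finset.sum_mul_sum, Finset.sum_mul_sum, Finset.sum_mul_sum]
    simp only [Finset.mul_sum, ← Finset.sum_add_distrib,
      ← Finset.sum_sub_distrib]
    refine Finset.sum_congr rfl fun i _ => Finset.sum_congr rfl fun j _ => ?_
    ring
  rw [this, ha]; ring

lemma row_gap {n : ℕ} {y : Fin n → ℝ} (hy : Antitone y) (z : Fin n → ℝ) (F : Finset (Fin n))
    (h1 : ∀ d ∈ F, ∀ i, i ≤ d → y d ≤ z i) (h2 : ∀ d ∈ F, ∀ j, d < j → z j ≤ nxtV y d)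
    (a : Fin n → ℝ) (ha0 : ∀ j, 0 ≤ a j) (ha : ∑ j, a j = 1) :
    ∑ d ∈ F, (∑ i, ∑ j, a i * a j * cutInd d i j) * (y d - nxtV y d) ^ 2
      ≤ ∑ j, a j * z j ^ 2 - (∑ j, a j * z j) ^ 2 := by
  rw [row_var a z ha]
  have e1 : ∑ d ∈ F, (∑ i, ∑ j, a i * a j * cutInd d i j) * (y d - nxtV y d) ^ 2
      = ∑ i, ∑ j, a i * a j * ∑ d ∈ F, cutInd d i j * (y d - nxtV y d) ^ 2 := by
    simp only [Finset.sum_mul, Finset.mul_sum]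
    rw [Finset.sum_comm]
    refine Finset.sum_congr rfl fun i _ => ?_
    rw [Finset.sum_comm]
    refine Finset.sum_congr rfl fun j _ => Finset.sum_congr rfl fun d _ => ?_
    ring
  have e2 : ∑ i, ∑ j, a i * a j * ∑ d ∈ F, cutInd d i j * (y d - nxtV y d) ^ 2
      ≤ ∑ i, ∑ j, a i * a j * (if i < j then (z i - z j) ^ 2 else 0) := by
    refine Finset.sum_le_sum fun i _ => Finset.sum_le_sum fun j _ => ?_
    exact mul_le_mul_of_nonneg_left (pair_le hy z F h1 h2 i j) (mul_nonneg (ha0 i) (ha0 j))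
  have e3 : ∑ i, ∑ j, a i * a j * (if i < j then (z i - z j) ^ 2 else 0)
      = ∑ i, ∑ j, a i * a j * (if j < i then (z i - z j) ^ 2 else 0) := by
    rw [Finset.sum_comm]
    refine Finset.sum_congr rfl fun i _ => Finset.sum_congr rfl fun j _ => ?_
    split_ifs <;> ring
  have e4 : ∑ i, ∑ j, a i * a j * (z i - z j) ^ 2
      = ∑ i, ∑ j, a i * a j * (if i < j then (z i - z j) ^ 2 else 0)
        + ∑ i, ∑ j, a i * a j * (if j < i then (z i - z j) ^ 2 else 0) := by
    simp only [← Finset.sum_add_distrib]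
    refine Finset.sum_congr rfl fun i _ => Finset.sum_congr rfl fun j _ => ?_
    rcases lt_trichotomy i j with h | h | h
    · simp [h, h.not_gt]
    · simp [h]
    · simp [h, h.not_gt]
  rw [e1, e4, ← e3]
  linarith

lemma cut_nonneg {n : ℕ} (a : Fin n → ℝ) (ha0 : ∀ j, 0 ≤ a j) (d : Fin n) :
    0 ≤ ∑ i, ∑ j, a i * a j * cutInd d i j := by
  refine Finset.sum_nonneg fun i _ => Finset.sum_nonneg fun j _ => ?_
  unfold cutInd
  exact mul_nonneg (mul_nonneg (ha0 i) (ha0 j)) (by split_ifs <;> norm_num)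

lemma cut_row {n : ℕ} {η : ℝ} (a : Fin n → ℝ) (ha0 : ∀ j, 0 ≤ a j) (ha : ∑ j, a j = 1)
    (d p q : Fin n) (hp : p ≤ d) (hq : d < q) (hp' : η ≤ a p) (hq' : η ≤ a q) (hη : 0 < η) :
    η / 2 ≤ ∑ i, ∑ j, a i * a j * cutInd d i j := by
  have e : ∑ i, ∑ j, a i * a j * cutInd d i j
      = (∑ i with i ≤ d, a i) * (∑ j with ¬ j ≤ d, a j) := by
    rw [Finset.sum_filter, Finset.sum_filter, Finset.sum_mul_sum]
    refine Finset.sum_congr rfl fun i _ => Finset.sum_congr rfl fun j _ => ?_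
    unfold cutInd
    by_cases h1 : i ≤ d <;> by_cases h2 : j ≤ d <;> simp [h1, h2, not_lt.2, not_le.1]
  have s := Finset.sum_filter_add_sum_filter_not Finset.univ (fun i => i ≤ d) a
  have l1 : a p ≤ ∑ i with i ≤ d, a i :=
    Finset.single_le_sum (f := a) (fun i _ => ha0 i) (by simp [hp])
  have l2 : a q ≤ ∑ i with ¬ i ≤ d, a i :=
    Finset.single_le_sum (f := a) (fun i _ => ha0 i) (by simp [hq])
  rw [e]
  rw [ha] at s
  set U := ∑ i with i ≤ d, a i
  set W := ∑ i with ¬ i ≤ d, a i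
  rcases le_total U (1/2) with h | h
  · nlinarith
  · nlinarith

lemma cut_mat {n : ℕ} {η : ℝ} (hη : 0 < η) (M : Matrix (Fin n) (Fin n) ℝ) (hM : GoodWeights η M)
    (d : Fin n) (hd : CrossAt M d) :
    η / 2 ≤ ∑ k, ∑ i, ∑ j, M k i * M k j * cutInd d i j := by
  obtain ⟨⟨h0, hr, hc⟩, hdiag, hge⟩ := hM
  obtain ⟨i, j, hi, hj, h⟩ := hd
  have key : ∀ k, η / 2 ≤ ∑ i, ∑ j, M k i * M k j * cutInd d i j →
      η / 2 ≤ ∑ k, ∑ i, ∑ j, M k i * M k j * cutInd d i j := fun k hk =>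
    hk.trans (Finset.single_le_sum (f := fun k => ∑ i, ∑ j, M k i * M k j * cutInd d i j)
      (fun k _ => cut_nonneg (M k) (h0 k) d) (Finset.mem_univ k))
  rcases h with h | h
  · exact key i (cut_row (M i) (h0 i) (hr i) d i j hi hj (hge _ _ (hdiag i)) (hge _ _ h) hη)
  · exact key j (cut_row (M j) (h0 j) (hr j) d i j hi hj (hge _ _ h) (hge _ _ (hdiag j)) hη)

lemma step_var {n : ℕ} {η : ℝ} (hη : 0 < η) (M : Matrix (Fin n) (Fin n) ℝ) (hM : GoodWeights η M)
    {y : Fin n → ℝ} (hy : Antitone y) (z : Fin n → ℝ) (F : Finset (Fin n))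
    (h1 : ∀ d ∈ F, ∀ i, i ≤ d → y d ≤ z i) (h2 : ∀ d ∈ F, ∀ j, d < j → z j ≤ nxtV y d)
    (hF : ∀ d ∈ F, CrossAt M d) (m : ℝ) :
    η / 2 * ∑ d ∈ F, (y d - nxtV y d) ^ 2
      ≤ ∑ i, (z i - m) ^ 2 - ∑ k, ((∑ j, M k j * z j) - m) ^ 2 := by
  have hM' := hM
  obtain ⟨⟨h0, hr, hc⟩, hdiag, hge⟩ := hM
  have A1 : ∑ k, ∑ d ∈ F, (∑ i, ∑ j, M k i * M k j * cutInd d i j) * (y d - nxtV y d) ^ 2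
      ≤ ∑ k, (∑ j, M k j * z j ^ 2 - (∑ j, M k j * z j) ^ 2) :=
    Finset.sum_le_sum fun k _ => row_gap hy z F h1 h2 (M k) (h0 k) (hr k)
  have A2 : η / 2 * ∑ d ∈ F, (y d - nxtV y d) ^ 2 ≤
      ∑ k, ∑ d ∈ F, (∑ i, ∑ j, M k i * M k j * cutInd d i j) * (y d - nxtV y d) ^ 2 := by
    rw [Finset.sum_comm, Finset.mul_sum]
    refine Finset.sum_le_sum fun d hd => ?_
    rw [← Finset.sum_mul]
    exact mul_le_mul_of_nonneg_right (cut_mat hη M hM' d (hF d hd)) (sq_nonneg _)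
  have C : ∀ f : Fin n → ℝ, ∑ k, ∑ j, M k j * f j = ∑ j, f j := by
    intro f
    rw [Finset.sum_comm]
    refine Finset.sum_congr rfl fun j _ => ?_
    rw [← Finset.sum_mul, hc, one_mul]
  have A3 : ∑ i, (z i - m) ^ 2 - ∑ k, ((∑ j, M k j * z j) - m) ^ 2
      = ∑ k, (∑ j, M k j * z j ^ 2 - (∑ j, M k j * z j) ^ 2) := by
    have b1 : ∑ i, (z i - m) ^ 2 = ∑ i, z i ^ 2 - 2 * m * ∑ i, z i + ∑ _i : Fin n, m ^ 2 := by
      rw [Finset.mul_sum, ← Finset.sum_sub_distrib, ← Finset.sum_add_distrib]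
      exact Finset.sum_congr rfl fun i _ => by ring
    have b2 : ∑ k, ((∑ j, M k j * z j) - m) ^ 2 = ∑ k, (∑ j, M k j * z j) ^ 2
        - 2 * m * ∑ k, (∑ j, M k j * z j) + ∑ _i : Fin n, m ^ 2 := by
      rw [Finset.mul_sum, ← Finset.sum_sub_distrib, ← Finset.sum_add_distrib]
      exact Finset.sum_congr rfl fun i _ => by ring
    rw [b1, b2, Finset.sum_sub_distrib, C, C fun j => z j ^ 2]
    ring
  rw [A3]
  exact A2.trans A1

lemma qfloor_le' {Q : ℕ} (hQ : 0 < Q) (y : ℝ) : qfloor Q y ≤ y := by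
  unfold qfloor
  have : (0:ℝ) < Q := by exact_mod_cast hQ
  rw [div_le_iff₀ this, mul_comm]
  exact Int.floor_le _

lemma le_qfloor' {Q : ℕ} (hQ : 0 < Q) (y c : ℝ) (hc : ∃ m : ℤ, c = (m : ℝ) / Q) (h : c ≤ y) :
    c ≤ qfloor Q y := by
  obtain ⟨m, rfl⟩ := hc
  unfold qfloor
  have hQ' : (0:ℝ) < Q := by exact_mod_cast hQ
  rw [div_le_iff₀ hQ'] at h
  apply div_le_div_of_nonneg_right _ hQ'.le
  exact_mod_cast Int.le_floor.2 (by linarith)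

lemma avg_le {n : ℕ} (a z : Fin n → ℝ) (ha0 : ∀ j, 0 ≤ a j) (ha : ∑ j, a j = 1) (c : ℝ)
    (h : ∀ j, 0 < a j → z j ≤ c) : ∑ j, a j * z j ≤ c := by
  calc ∑ j, a j * z j ≤ ∑ j, a j * c := by
        refine Finset.sum_le_sum fun j _ => ?_
        rcases (ha0 j).eq_or_lt with e | e
        · simp [← e]
        · exact mul_le_mul_of_nonneg_left (h j e) (ha0 j)
    _ = c := by rw [← Finset.sum_mul, ha, one_mul]

lemma le_avg {n : ℕ} (a z : Fin n → ℝ) (ha0 : ∀ j, 0 ≤ a j) (ha : ∑ j, a j = 1) (c : ℝ)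
    (h : ∀ j, 0 < a j → c ≤ z j) : c ≤ ∑ j, a j * z j := by
  have := avg_le a (fun j => - z j) ha0 ha (-c) (fun j hj => by linarith [h j hj])
  simp only [mul_neg, Finset.sum_neg_distrib] at this
  linarith

lemma step_under {n : ℕ} {η : ℝ} (hη : 0 < η) {Q : ℕ} (hQ : 0 < Q)
    (M : Matrix (Fin n) (Fin n) ℝ) (hM : GoodWeights η M)
    {y : Fin n → ℝ} (hy : Antitone y) (z z' : Fin n → ℝ) (F : Finset (Fin n))
    (h1 : ∀ d ∈ F, ∀ i, i ≤ d → y d ≤ z i) (h2 : ∀ d ∈ F, ∀ j, d < j → z j ≤ nxtV y d)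
    (hF : ∀ d ∈ F, CrossAt M d) (hz : ∀ i, ∃ m : ℤ, z i = (m : ℝ) / Q)
    (hz' : ∀ i, z' i = qfloor Q (M.mulVec z i)) :
    η / 2 * ∑ d ∈ F, (y d - nxtV y d) ^ 2 ≤ underVar z - underVar z' := by
  refine (step_var hη M hM hy z F h1 h2 hF (⨅ j, z j)).trans ?_
  unfold underVar
  apply sub_le_sub_left
  rcases isEmpty_or_nonempty (Fin n) with hn | hn
  · simp
  refine Finset.sum_le_sum fun i _ => ?_
  obtain ⟨i0, hi0⟩ := exists_eq_ciInf_of_finite (f := z)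
  have hmin : ∀ j, ⨅ j, z j ≤ z j := fun j => ciInf_le (Set.finite_range z).bddBelow j
  have hmin' : ∀ j, ⨅ j, z' j ≤ z' j := fun j => ciInf_le (Set.finite_range z').bddBelow j
  have hmm : ⨅ j, z j ≤ ⨅ j, z' j := by
    refine le_ciInf fun j => ?_
    rw [hz' j]
    apply le_qfloor' hQ
    · rw [← hi0]; exact hz i0
    · exact le_avg (M j) z (hM.1.1 j) (hM.1.2.1 j) _ fun l _ => hmin l
  have hle : z' i ≤ ∑ j, M i j * z j := by rw [hz' i]; exact qfloor_le' hQ _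
  have := hmin' i
  apply pow_le_pow_left₀ <;> linarith

/-- the analogue of Statement 4 for the quantized update and the Lyapunov
function `V̲`: `V̲(x(kB)) - V̲(x((k+1)B)) ≥ (η/2) Σ_{i=1}^{n-1} (x_i(kB) - x_{i+1}(kB))²`. -/
theorem stmt13 {n : ℕ} (η : ℝ) (hη : 0 < η) (B : ℕ) (hB : 1 ≤ B) (Q : ℕ) (hQ : 0 < Q)
    (A : ℕ → Matrix (Fin n) (Fin n) ℝ) (hA : ∀ k, GoodWeights η (A k))
    (x : ℕ → Fin n → ℝ)
    (hquant : ∀ i, ∃ m : ℤ, x 0 i = (m : ℝ) / Q)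
    (hx : ∀ k i, x (k + 1) i = qfloor Q ((A k).mulVec (x k) i))
    (k : ℕ) (hord : Antitone (x (k * B)))
    (hcut : CutCondition A B k (x (k * B))) :
    η / 2 * sumSqDiff (x (k * B)) ≤ underVar (x (k * B)) - underVar (x ((k + 1) * B)) := by
  classical
  have hq : ∀ t i, ∃ m : ℤ, x t i = (m : ℝ) / Q := by
    intro t i
    cases t with
    | zero => exact hquant i
    | succ t => exact ⟨_, hx t i⟩
  set T := k * B with hT
  set y := x T with hyd
  have inv : ∀ s d, (∀ r < s, ¬ CrossAt (A (T + r)) d) →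
      (∀ i, i ≤ d → y d ≤ x (T + s) i) ∧ (∀ j, d < j → x (T + s) j ≤ nxtV y d) := by
    intro s d
    induction s with
    | zero =>
      intro _
      exact ⟨fun i hi => hord hi, fun j hj => le_nxtV hord hj⟩
    | succ s ih =>
      intro h
      obtain ⟨g1, g2⟩ := ih fun r hr => h r (by omega)
      have hc := h s (by omega)
      obtain ⟨⟨h0, hr, -⟩, -⟩ := hA (T + s)
      refine ⟨fun i hi => ?_, fun j hj => ?_⟩
      · rw [← add_assoc, hx]
        apply le_qfloor' hQ _ _ (hq T d)
        refine le_avg (A (T + s) i) _ (h0 i) (hr i) _ fun l hl => g1 l ?_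
        by_contra hld
        exact hc ⟨i, l, hi, not_le.1 hld, Or.inl hl⟩
      · rw [← add_assoc, hx]
        refine (qfloor_le' hQ _).trans ?_
        refine avg_le (A (T + s) j) _ (h0 j) (hr j) _ fun l hl => g2 l ?_
        by_contra hld
        exact hc ⟨l, j, not_lt.1 hld, hj, Or.inr hl⟩
  have main : ∀ s, η / 2 * ∑ d with (∃ r < s, CrossAt (A (T + r)) d), (y d - nxtV y d) ^ 2
      ≤ underVar y - underVar (x (T + s)) := by
    intro s
    induction s with
    | zero => simp [hyd]
    | succ s ih =>
      have st := step_under hη hQ (A (T + s)) (hA _) hord (x (T + s)) (x (T + s + 1))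
        (Finset.univ.filter fun d => (¬ ∃ r < s, CrossAt (A (T + r)) d) ∧ CrossAt (A (T + s)) d)
        (fun d hd => (inv s d (by simpa using (Finset.mem_filter.1 hd).2.1)).1)
        (fun d hd => (inv s d (by simpa using (Finset.mem_filter.1 hd).2.1)).2)
        (fun d hd => (Finset.mem_filter.1 hd).2.2) (hq _) (hx _)
      have un : (Finset.univ.filter fun d => ∃ r < s + 1, CrossAt (A (T + r)) d)
          = (Finset.univ.filter fun d => ∃ r < s, CrossAt (A (T + r)) d) ∪
            (Finset.univ.filter fun d =>
              (¬ ∃ r < s, CrossAt (A (T + r)) d) ∧ CrossAt (A (T + s)) d) := by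
        ext d
        simp only [Finset.mem_filter, Finset.mem_union, Finset.mem_univ, true_and]
        constructor
        · rintro ⟨r, hr, hc⟩
          by_cases h : ∃ r < s, CrossAt (A (T + r)) d
          · exact Or.inl h
          · right
            refine ⟨h, ?_⟩
            have : r = s := by
              by_contra hne
              exact h ⟨r, by omega, hc⟩
            rwa [← this]
        · rintro (⟨r, hr, hc⟩ | ⟨-, hc⟩)
          · exact ⟨r, by omega, hc⟩
          · exact ⟨s, by omega, hc⟩
      rw [un, Finset.sum_union]
      · rw [mul_add, ← add_assoc]
        linarith
      · rw [Finset.disjoint_left]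
        intro d h h'
        exact (Finset.mem_filter.1 h').2.1 (Finset.mem_filter.1 h).2
  have hTB : (k + 1) * B = T + B := by rw [hT]; ring
  have fin := main B
  rw [hTB]
  refine le_trans (le_of_eq ?_) fin
  rw [sumSqDiff_eq_nxt]
  congr 1
  symm
  apply Finset.sum_filter_of_ne
  intro d _ hne
  by_cases h : (d : ℕ) + 1 < n
  · rcases hcut d h with e | ⟨t, ht1, ht2, hc⟩
    · exact absurd (by simp [nxtV, h, ← e]) hne
    · exact ⟨t - T, by omega, by rw [Nat.add_sub_cancel' ht1]; exact hc⟩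
  · exact absurd (by simp [nxtV, h]) hne
end
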